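/- arXiv:1405.4964 — 2 statements merged into one kernel-verified Lean document; each statement's English description precedes it below -/
import Mathlib

section
/- The Hochschild one-cocycle identity fails for B₊⁴ at the element Γ₄₄: one has Δ(B₊⁴(Γ₄₄)) = 0, whereas B₊⁴(Γ₄₄) ⊗ 1 + (id ⊗ B₊⁴)(Δ(Γ₄₄)) = Γ₄₄ ⊗ Γ₄ + Γ₄ ⊗ Γ₄₄ ≠ 0; in particular Δ(B₊⁴(Γ₄₄)) ≠ B₊⁴(Γ₄₄) ⊗ 1 + (id ⊗ B₊⁴)(Δ(Γ₄₄)). -/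
/-!
The Hopf algebra `H = ℚ[Γ₃, Γ₄, Γ₃₃, Γ₄₄, Γ₄₃, Γ₃₄ₐ, Γ₃₄ᵦ]` of wheels in wheels,
with the insertion operators `B₊³`, `B₊⁴` defined on the monomial basis.
Generators are indexed by `Fin 7` in the order Γ₃, Γ₄, Γ₃₃, Γ₄₄, Γ₄₃, Γ₃₄ₐ, Γ₃₄ᵦ.
-/

open TensorProduct

noncomputable section WheelHopf

abbrev H : Type := MvPolynomial (Fin 7) ℚ

/-- The seven generators. -/
def Γ (i : Fin 7) : H := MvPolynomial.X i

/-- Images of the generators under the coproduct. -/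
def ΔGen : Fin 7 → H ⊗[ℚ] H :=
  ![Γ 0 ⊗ₜ 1 + 1 ⊗ₜ Γ 0,
    Γ 1 ⊗ₜ 1 + 1 ⊗ₜ Γ 1,
    Γ 2 ⊗ₜ 1 + 1 ⊗ₜ Γ 2 + Γ 0 ⊗ₜ Γ 0,
    Γ 3 ⊗ₜ 1 + 1 ⊗ₜ Γ 3 + Γ 1 ⊗ₜ Γ 1,
    Γ 4 ⊗ₜ 1 + 1 ⊗ₜ Γ 4 + Γ 1 ⊗ₜ Γ 0,
    Γ 5 ⊗ₜ 1 + 1 ⊗ₜ Γ 5 + Γ 0 ⊗ₜ Γ 1,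
    Γ 6 ⊗ₜ 1 + 1 ⊗ₜ Γ 6 + Γ 0 ⊗ₜ Γ 1]

/-- The coproduct `Δ : H → H ⊗ H`, a `ℚ`-algebra homomorphism. -/
def Δ : H →ₐ[ℚ] H ⊗[ℚ] H := MvPolynomial.aeval ΔGen

/-- Values of `B₊³` on the monomial basis: `B₊³(1) = Γ₃`, `B₊³(Γ₃) = Γ₃₃`,
`B₊³(Γ₄) = Γ₄₃`, and `0` on every other monomial. -/
def B3val : (Fin 7 →₀ ℕ) → H := fun m =>
  if m = 0 then Γ 0
  else if m = Finsupp.single 0 1 then Γ 2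
  else if m = Finsupp.single 1 1 then Γ 4
  else 0

/-- Values of `B₊⁴` on the monomial basis: `B₊⁴(1) = Γ₄`, `B₊⁴(Γ₄) = Γ₄₄`,
`B₊⁴(Γ₃) = ½(Γ₃₄ₐ + Γ₃₄ᵦ)`, and `0` on every other monomial. -/
def B4val : (Fin 7 →₀ ℕ) → H := fun m =>
  if m = 0 then Γ 1
  else if m = Finsupp.single 1 1 then Γ 3
  else if m = Finsupp.single 0 1 then (1/2 : ℚ) • (Γ 5 + Γ 6)
  else 0

/-- The `ℚ`-linear map `B₊³ : H → H`. -/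
def B3 : H →ₗ[ℚ] H := (MvPolynomial.basisMonomials (Fin 7) ℚ).constr ℚ B3val

/-- The `ℚ`-linear map `B₊⁴ : H → H`. -/
def B4 : H →ₗ[ℚ] H := (MvPolynomial.basisMonomials (Fin 7) ℚ).constr ℚ B4val

end WheelHopf


open TensorProduct

theorem B4_monomial (m : Fin 7 →₀ ℕ) : B4 (MvPolynomial.monomial m 1) = B4val m := by
  have h := (MvPolynomial.basisMonomials (Fin 7) ℚ).constr_basis ℚ B4val m
  rwa [MvPolynomial.coe_basisMonomials] at h

theorem B4_one : B4 1 = Γ 1 := by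
  have h := B4_monomial 0
  rw [MvPolynomial.monomial_zero', map_one] at h
  rw [h]
  simp [B4val]

theorem B4_G1 : B4 (Γ 1) = Γ 3 := by
  have h := B4_monomial (Finsupp.single 1 1)
  change B4 (Γ 1) = _ at h
  rw [h]
  simp [B4val]

theorem B4_G3 : B4 (Γ 3) = 0 := by
  have h := B4_monomial (Finsupp.single 3 1)
  change B4 (Γ 3) = _ at h
  rw [h]
  simp [B4val, Finsupp.single_left_inj]

theorem Δ_G3 : Δ (Γ 3) = Γ 3 ⊗ₜ 1 + 1 ⊗ₜ Γ 3 + Γ 1 ⊗ₜ Γ 1 := by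
  unfold Δ
  conv_lhs => rw [Γ, MvPolynomial.aeval_X]
  rfl

theorem rhs_ne_zero : (Γ 3 ⊗ₜ[ℚ] Γ 1 + Γ 1 ⊗ₜ[ℚ] Γ 3 : H ⊗[ℚ] H) ≠ 0 := by
  intro h
  have h2 := congrArg (fun t => MvPolynomial.aeval (fun _ : Fin 7 => (1 : ℚ))
    (Algebra.TensorProduct.lmul' ℚ (S := H) t)) h
  simp [Γ] at h2

/-- The Hochschild one-cocycle identity fails for `B₊⁴` at `Γ₄₄`:
`Δ(B₊⁴(Γ₄₄)) = 0` while `B₊⁴(Γ₄₄) ⊗ 1 + (id ⊗ B₊⁴)(Δ(Γ₄₄)) = Γ₄₄ ⊗ Γ₄ + Γ₄ ⊗ Γ₄₄ ≠ 0`;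
in particular the two sides differ. -/
theorem Bplus_cocycle_fails :
    (Δ (B4 (Γ 3)) = 0)
    ∧ (B4 (Γ 3) ⊗ₜ[ℚ] 1 + LinearMap.lTensor H B4 (Δ (Γ 3))
        = Γ 3 ⊗ₜ[ℚ] Γ 1 + Γ 1 ⊗ₜ[ℚ] Γ 3)
    ∧ (Γ 3 ⊗ₜ[ℚ] Γ 1 + Γ 1 ⊗ₜ[ℚ] Γ 3 : H ⊗[ℚ] H) ≠ 0
    ∧ (Δ (B4 (Γ 3)) ≠ B4 (Γ 3) ⊗ₜ[ℚ] 1 + LinearMap.lTensor H B4 (Δ (Γ 3))) := by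
  have e : B4 (Γ 3) ⊗ₜ[ℚ] 1 + LinearMap.lTensor H B4 (Δ (Γ 3))
        = Γ 3 ⊗ₜ[ℚ] Γ 1 + Γ 1 ⊗ₜ[ℚ] Γ 3 := by
    rw [Δ_G3, map_add, map_add, LinearMap.lTensor_tmul, LinearMap.lTensor_tmul,
      LinearMap.lTensor_tmul, B4_G3, B4_one, B4_G1, TensorProduct.zero_tmul,
      TensorProduct.tmul_zero, zero_add, add_zero]
  have z : Δ (B4 (Γ 3)) = 0 := by rw [B4_G3, map_zero]
  refine ⟨z, e, rhs_ne_zero, ?_⟩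
  rw [z, e]
  exact rhs_ne_zero.symm
end

section
/- With σ := S ⋆ P the convolution of the antipode with the projection onto the augmentation ideal, the element s₃₄ := ½Γ₃₄ₐ + ½Γ₃₄ᵦ + Γ₄₃ has co-radical degree two: σ(s₃₄) ≠ 0 is not primitive-compatible at degree one, namely σ^{⋆2}(s₃₄) = 2·Γ₃Γ₄ ≠ 0, while σ^{⋆3}(s₃₄) = 0. -/
/-!
The Hopf algebra `H = ℚ[Γ₃, Γ₄, Γ₃₃, Γ₄₄, Γ₄₃, Γ₃₄ₐ, Γ₃₄ᵦ]` of wheels in wheels.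
Generators are indexed by `Fin 7` in the order Γ₃, Γ₄, Γ₃₃, Γ₄₄, Γ₄₃, Γ₃₄ₐ, Γ₃₄ᵦ.
-/

open TensorProduct

noncomputable section WheelHopf

/-- The counit `ε : H → ℚ`, sending every generator to `0`. -/
def ε : H →ₐ[ℚ] ℚ := MvPolynomial.aeval 0

/-- The antipode `S : H → H`, a `ℚ`-algebra homomorphism. -/
def Santi : H →ₐ[ℚ] H := MvPolynomial.aeval
  ![-Γ 0, -Γ 1, -Γ 2 + Γ 0 ^ 2, -Γ 3 + Γ 1 ^ 2,
    -Γ 4 + Γ 1 * Γ 0, -Γ 5 + Γ 0 * Γ 1, -Γ 6 + Γ 0 * Γ 1]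

/-- The projection `P = id − η∘ε` onto the augmentation ideal. -/
def Paug : H →ₗ[ℚ] H :=
  LinearMap.id - (Algebra.linearMap ℚ H) ∘ₗ ε.toLinearMap

/-- The convolution product `f ⋆ g = m ∘ (f ⊗ g) ∘ Δ` of linear maps `H → H`. -/
def conv (f g : H →ₗ[ℚ] H) : H →ₗ[ℚ] H :=
  LinearMap.mul' ℚ H ∘ₗ TensorProduct.map f g ∘ₗ Δ.toLinearMap

/-- `σ = S ⋆ P`, the convolution of the antipode with the projection onto the
augmentation ideal. -/
def σconv : H →ₗ[ℚ] H := conv Santi.toLinearMap Paug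

end WheelHopf


theorem conv_apply_prim (f g : H →ₗ[ℚ] H) (x : H)
    (hx : Δ x = x ⊗ₜ 1 + 1 ⊗ₜ x) :
    conv f g x = f x * g 1 + f 1 * g x := by
  simp [conv, hx]

theorem conv_apply_two (f g : H →ₗ[ℚ] H) (x a b : H)
    (hx : Δ x = x ⊗ₜ 1 + 1 ⊗ₜ x + a ⊗ₜ b) :
    conv f g x = f x * g 1 + f 1 * g x + f a * g b := by
  simp [conv, hx]

theorem conv_apply_one (f g : H →ₗ[ℚ] H) : conv f g 1 = f 1 * g 1 := by
  simp [conv, Algebra.TensorProduct.one_def]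

theorem Δ_Γ (i : Fin 7) : Δ (Γ i) = ΔGen i := by
  simp [Δ, Γ]

theorem Δ_Γ0 : Δ (Γ 0) = Γ 0 ⊗ₜ 1 + 1 ⊗ₜ Γ 0 := Δ_Γ 0
theorem Δ_Γ1 : Δ (Γ 1) = Γ 1 ⊗ₜ 1 + 1 ⊗ₜ Γ 1 := Δ_Γ 1
theorem Δ_Γ4 : Δ (Γ 4) = Γ 4 ⊗ₜ 1 + 1 ⊗ₜ Γ 4 + Γ 1 ⊗ₜ Γ 0 := Δ_Γ 4
theorem Δ_Γ5 : Δ (Γ 5) = Γ 5 ⊗ₜ 1 + 1 ⊗ₜ Γ 5 + Γ 0 ⊗ₜ Γ 1 := Δ_Γ 5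
theorem Δ_Γ6 : Δ (Γ 6) = Γ 6 ⊗ₜ 1 + 1 ⊗ₜ Γ 6 + Γ 0 ⊗ₜ Γ 1 := Δ_Γ 6

theorem Paug_one : Paug 1 = 0 := by simp [Paug]

theorem Paug_Γ (i : Fin 7) : Paug (Γ i) = Γ i := by simp [Paug, ε, Γ]

theorem Santi_Γ0 : Santi (Γ 0) = -Γ 0 := by simp [Santi, Γ]
theorem Santi_Γ1 : Santi (Γ 1) = -Γ 1 := by simp [Santi, Γ]

theorem σ_one : σconv 1 = 0 := by
  simp [σconv, conv_apply_one, Paug_one]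

theorem σ_Γ0 : σconv (Γ 0) = Γ 0 := by
  simp [σconv, conv_apply_prim _ _ _ Δ_Γ0, Paug_one, Paug_Γ]

theorem σ_Γ1 : σconv (Γ 1) = Γ 1 := by
  simp [σconv, conv_apply_prim _ _ _ Δ_Γ1, Paug_one, Paug_Γ]

theorem σ_Γ4 : σconv (Γ 4) = Γ 4 - Γ 1 * Γ 0 := by
  simp [σconv, conv_apply_two _ _ _ _ _ Δ_Γ4, Paug_one, Paug_Γ, Santi_Γ1, sub_eq_add_neg]

theorem σ_Γ5 : σconv (Γ 5) = Γ 5 - Γ 0 * Γ 1 := by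
  simp [σconv, conv_apply_two _ _ _ _ _ Δ_Γ5, Paug_one, Paug_Γ, Santi_Γ0, sub_eq_add_neg]

theorem σ_Γ6 : σconv (Γ 6) = Γ 6 - Γ 0 * Γ 1 := by
  simp [σconv, conv_apply_two _ _ _ _ _ Δ_Γ6, Paug_one, Paug_Γ, Santi_Γ0, sub_eq_add_neg]

/-- The element `s₃₄ = ½Γ₃₄ₐ + ½Γ₃₄ᵦ + Γ₄₃` has co-radical degree two:
`σ(s₃₄) ≠ 0`, `σ^{⋆2}(s₃₄) = 2·Γ₃Γ₄ ≠ 0`, while `σ^{⋆3}(s₃₄) = 0`. -/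
theorem s34_coradical_degree_two :
    σconv ((1/2 : ℚ) • Γ 5 + (1/2 : ℚ) • Γ 6 + Γ 4 : H) ≠ 0
    ∧ conv σconv σconv ((1/2 : ℚ) • Γ 5 + (1/2 : ℚ) • Γ 6 + Γ 4 : H)
        = 2 * (Γ 0 * Γ 1)
    ∧ (2 * (Γ 0 * Γ 1) : H) ≠ 0
    ∧ conv σconv (conv σconv σconv) ((1/2 : ℚ) • Γ 5 + (1/2 : ℚ) • Γ 6 + Γ 4 : H) = 0 := by
  refine ⟨?_, ?_, ?_, ?_⟩
  · intro h
    rw [map_add, map_add, map_smul, map_smul, σ_Γ4, σ_Γ5, σ_Γ6] at h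
    have h2 := congrArg (MvPolynomial.eval (fun i : Fin 7 => if i = 4 then (1 : ℚ) else 0)) h
    simp [Γ, MvPolynomial.smul_eval] at h2
  · rw [map_add, map_add, map_smul, map_smul, conv_apply_two _ _ _ _ _ Δ_Γ4,
      conv_apply_two _ _ _ _ _ Δ_Γ5, conv_apply_two _ _ _ _ _ Δ_Γ6, σ_one, σ_Γ0, σ_Γ1]
    simp only [mul_zero, zero_mul, zero_add]
    rw [← add_smul]
    norm_num
    ring
  · intro h
    have h2 := congrArg (MvPolynomial.eval (fun _ : Fin 7 => (1 : ℚ))) h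
    simp [Γ] at h2
  · rw [map_add, map_add, map_smul, map_smul, conv_apply_two _ _ _ _ _ Δ_Γ4,
      conv_apply_two _ _ _ _ _ Δ_Γ5, conv_apply_two _ _ _ _ _ Δ_Γ6, conv_apply_one,
      conv_apply_prim _ _ _ Δ_Γ0, conv_apply_prim _ _ _ Δ_Γ1, σ_one]
    simp
end
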